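/- With M = {y₁ = 0} ⊂ ℝ⁶ and the almost complex structure J determined by JL₁ = L₂, JL₃ = L₄, JL₅ = L₆ as in the context: there exist no ρ > 0 and no smooth J-holomorphic map γ : {ζ ∈ ℂ : |ζ| < ρ} → ℝ⁶ such that γ(0) = 0, ∂γ/∂x(0) = L₅(0), and φ(γ(ζ)) = O(|ζ|⁵) as ζ → 0 (i.e. γ is tangent to M at 0 at order 5). -/

import Mathlib

noncomputable section

open Metric

/-- `ℝ^{2n}` identified with `ℂ^n`. -/
abbrev Ecx (n : ℕ) := EuclideanSpace ℂ (Fin n)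

/-- The standard complex structure `J₀` (multiplication by `i`), as a real-linear map. -/
def J0 (n : ℕ) : Ecx n →L[ℝ] Ecx n := Complex.I • ContinuousLinearMap.id ℝ (Ecx n)

variable {F : Type*} [NormedAddCommGroup F] [NormedSpace ℝ F]

/-- `J`-holomorphy of `γ` on a set `D ⊆ ℂ`: `dγ(ζ) ∘ J_st = J(γ ζ) ∘ dγ(ζ)`. -/
def JHolOn (J : F → F →L[ℝ] F) (D : Set ℂ) (γ : ℂ → F) : Prop :=
  ∀ ζ ∈ D, ∀ v : ℂ, fderiv ℝ γ ζ (Complex.I * v) = J (γ ζ) (fderiv ℝ γ ζ v)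


/-- Lie bracket of vector fields: `[X,Y](p) = dY(p)(X(p)) − dX(p)(Y(p))`. -/
def lieVF (X Y : F → F) : F → F :=
  fun p => fderiv ℝ Y p (X p) - fderiv ℝ X p (Y p)

/-- The vector field `JX : x ↦ J(x) X(x)`. -/
def Jvf (J : F → F →L[ℝ] F) (X : F → F) : F → F := fun p => J p (X p)

/-- The flat covariant derivative `X · Y : p ↦ dY(p)(X(p))`. -/
def derVF (X Y : F → F) : F → F := fun p => fderiv ℝ Y p (X p)

/-- `DX X Y k = D_X^{k,0} Y = X·(X·(⋯(X·Y)))` (`k` times). -/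
def DX (X Y : F → F) : ℕ → (F → F)
  | 0 => Y
  | k + 1 => derVF X (DX X Y k)

/-- `applyVF [X₁,…,X_k] Z = X₁·(X₂·(⋯(X_k·Z)))`. -/
def applyVF : List (F → F) → (F → F) → (F → F)
  | [], Z => Z
  | Y :: rest, Z => derVF Y (applyVF rest Z)

/-- `nestedLie [X₁,…,X_k] Z = [X₁,[X₂,[…,[X_k, Z]…]]]`. -/
def nestedLie : List (F → F) → (F → F) → (F → F)
  | [], Z => Z
  | Y :: rest, Z => lieVF Y (nestedLie rest Z)

/-- Selector for elements of `{X, JX}`: `pickVF X JX true = X`, `pickVF X JX false = JX`. -/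
def pickVF (X Y : F → F) (b : Bool) : F → F := if b then X else Y

/-- `X` commutes at order `k` at `p`: all iterated Lie brackets of length `l` with
`2 ≤ l ≤ k` of elements of `{X, JX}` vanish at `p`. -/
def CommutesAtOrder (J : F → F →L[ℝ] F) (X : F → F) (k : ℕ) (p : F) : Prop :=
  ∀ m : ℕ, 1 ≤ m → m + 1 ≤ k → ∀ b : Fin m → Bool, ∀ c : Bool,
    nestedLie (List.ofFn fun i => pickVF X (Jvf J X) (b i))
      (pickVF X (Jvf J X) c) p = 0


/-- `ℝ⁶` with coordinates `(x₁,y₁,x₂,y₂,x₃,y₃) = (p 0, p 1, p 2, p 3, p 4, p 5)`. -/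
abbrev R6 := Fin 6 → ℝ

/-- standard basis vector -/
def e (i : Fin 6) : R6 := Pi.single i 1

/-- `L₁ = ∂/∂x₁` -/
def L1 : R6 → R6 := fun _ => e 0
/-- `L₂ = ∂/∂y₁` -/
def L2 : R6 → R6 := fun _ => e 1
/-- `L₃ = ∂/∂x₂ − (1/2) y₃² ∂/∂x₁` -/
def L3 : R6 → R6 := fun p => e 2 - ((1 / 2) * (p 5) ^ 2) • e 0
/-- `L₄ = ∂/∂y₂ + (x₂ − 2 x₃ y₃) ∂/∂x₁` -/
def L4 : R6 → R6 := fun p => e 3 + (p 2 - 2 * p 4 * p 5) • e 0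
/-- `L₅ = ∂/∂x₃ − y₂ y₃ ∂/∂x₁` -/
def L5 : R6 → R6 := fun p => e 4 - (p 3 * p 5) • e 0
/-- `L₆ = ∂/∂y₃ + x₃ ∂/∂x₂ − (x₃ y₃²/2 + x₃ y₂) ∂/∂x₁` -/
def L6 : R6 → R6 := fun p => e 5 + p 4 • e 2 - (p 4 * (p 5) ^ 2 / 2 + p 4 * p 3) • e 0

/-- the frame conditions determining the almost complex structure `J` -/
def FrameJ (J : R6 → R6 →L[ℝ] R6) : Prop :=
  ∀ p : R6, J p (L1 p) = L2 p ∧ J p (L2 p) = -L1 p ∧ J p (L3 p) = L4 p ∧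
    J p (L4 p) = -L3 p ∧ J p (L5 p) = L6 p ∧ J p (L6 p) = -L5 p

/-- the defining function `φ = y₁` of `M` -/
def phi6 : R6 → ℝ := fun p => p 1

/-- The derivative of `f` in the constant direction `v`. -/
def dirD (v : ℂ) (f : ℂ → ℝ) : ℂ → ℝ := fun ζ => fderiv ℝ f ζ v

lemma abs_le_mul_pow_succ_of_deriv {f f' : ℝ → ℝ} {C T : ℝ} {n : ℕ} (hC : 0 ≤ C)
    (hf : ∀ t ∈ Set.Icc 0 T, HasDerivAt f (f' t) t) (h0 : f 0 = 0)
    (hb : ∀ t ∈ Set.Icc 0 T, |f' t| ≤ C * t ^ n) :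
    ∀ t ∈ Set.Icc 0 T, |f t| ≤ C * t ^ (n + 1) := by
  intro t ht
  have := norm_image_sub_le_of_norm_deriv_le_segment' (f := f) (f' := f') (a := 0) (b := t)
    (C := C * t ^ n)
    (fun x hx => (hf x ⟨hx.1, hx.2.trans ht.2⟩).hasDerivWithinAt)
    (fun x hx => (hb x ⟨hx.1, hx.2.le.trans ht.2⟩).trans
      (mul_le_mul_of_nonneg_left (pow_le_pow_left₀ hx.1 hx.2.le n) hC)) t
    ⟨ht.1, le_rfl⟩
  rw [h0, sub_zero, sub_zero, Real.norm_eq_abs] at this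
  rwa [pow_succ, ← mul_assoc]

lemma abs_sub_taylor_le {C T : ℝ} (hC : 0 ≤ C) (n : ℕ) (h : ℕ → ℝ → ℝ)
    (hd : ∀ k, ∀ t ∈ Set.Icc 0 T, HasDerivAt (h k) (h (k + 1) t) t)
    (hb : ∀ t ∈ Set.Icc 0 T, |h n t| ≤ C) :
    ∀ t ∈ Set.Icc 0 T,
      |h 0 t - ∑ k ∈ Finset.range n, h k 0 * t ^ k / k.factorial| ≤ C * t ^ n := by
  induction n generalizing h with
  | zero => simpa using hb
  | succ n ih =>
    have ih' := ih (fun k => h (k + 1)) (fun k => hd (k + 1)) hb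
    refine abs_le_mul_pow_succ_of_deriv (n := n) hC (fun t ht => ?_) ?_ ih'
    · refine (hd 0 t ht).sub ?_
      simp only [Finset.sum_range_succ' _ n, pow_zero]
      refine HasDerivAt.add_const _ (HasDerivAt.fun_sum fun k _ => ?_)
      have := ((hasDerivAt_pow (k + 1) t).const_mul (h (k + 1) 0)).div_const
        ((k + 1).factorial : ℝ)
      convert! this using 1
      rw [Nat.factorial_succ]
      push_cast
      have : (k.factorial : ℝ) ≠ 0 := by positivity
      field_simp
    · simp [Finset.sum_range_succ' _ n]

lemma abs_second_deriv_le_of_forward_stencil {A C r : ℝ} (hC : 0 ≤ C) (hr : 0 < r)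
    (h : ℕ → ℝ → ℝ)
    (hd : ∀ k, ∀ t ∈ Set.Icc 0 (4 * r), HasDerivAt (h k) (h (k + 1) t) t)
    (hb : ∀ t ∈ Set.Icc 0 (4 * r), |h 5 t| ≤ C)
    (hA : ∀ t ∈ Set.Icc 0 (4 * r), |h 0 t| ≤ A * r ^ 5) :
    |h 2 0| ≤ (320 * A + 300000 * C) * r ^ 3 := by
  have key : 12 * r ^ 2 * |h 2 0| ≤ 12 * r ^ 2 * ((320 * A + 300000 * C) * r ^ 3) := by
    have tay := abs_sub_taylor_le hC 5 h hd hb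
    simp only [Finset.sum_range_succ, Finset.sum_range_zero, Nat.factorial] at tay
    have hCr : 0 ≤ C * r ^ 5 := by positivity
    have m (j : ℝ) (h0 : 0 ≤ j) (h4 : j ≤ 4) : j * r ∈ Set.Icc 0 (4 * r) :=
      ⟨by positivity, by gcongr⟩
    have t1 := abs_le.1 (tay _ (m 1 (by norm_num) (by norm_num)))
    have t2 := abs_le.1 (tay _ (m 2 (by norm_num) (by norm_num)))
    have t3 := abs_le.1 (tay _ (m 3 (by norm_num) (by norm_num)))
    have t4 := abs_le.1 (tay _ (m 4 (by norm_num) (by norm_num)))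
    have a0 := abs_le.1 (hA _ (m 0 (by norm_num) (by norm_num)))
    have a1 := abs_le.1 (hA _ (m 1 (by norm_num) (by norm_num)))
    have a2 := abs_le.1 (hA _ (m 2 (by norm_num) (by norm_num)))
    have a3 := abs_le.1 (hA _ (m 3 (by norm_num) (by norm_num)))
    have a4 := abs_le.1 (hA _ (m 4 (by norm_num) (by norm_num)))
    rw [zero_mul] at a0
    obtain ⟨t1, t1'⟩ := t1
    obtain ⟨t2, t2'⟩ := t2
    obtain ⟨t3, t3'⟩ := t3
    obtain ⟨t4, t4'⟩ := t4
    push_cast at t1 t2 t3 t4 t1' t2' t3' t4'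
    have hpos : (0 : ℝ) ≤ 12 * r ^ 2 := by positivity
    rw [← abs_of_nonneg hpos, ← abs_mul, abs_of_nonneg hpos, abs_le]
    constructor <;> nlinarith [a0.1, a0.2, a1.1, a1.2, a2.1, a2.2, a3.1, a3.2, a4.1, a4.2]
  exact le_of_mul_le_mul_left key (by positivity)

lemma contDiffOn_dirD {U : Set ℂ} (hU : IsOpen U) (v : ℂ) {f : ℂ → ℝ}
    (hf : ContDiffOn ℝ (⊤ : ℕ∞) f U) : ContDiffOn ℝ (⊤ : ℕ∞) (dirD v f) U :=
  (hf.fderiv_of_isOpen hU (by simp)).clm_apply contDiffOn_const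

lemma ContDiffOn.differentiableAt_of_isOpen {U : Set ℂ} (hU : IsOpen U) {f : ℂ → ℝ}
    (hf : ContDiffOn ℝ (⊤ : ℕ∞) f U) {ζ : ℂ} (hζ : ζ ∈ U) : DifferentiableAt ℝ f ζ :=
  (hf.contDiffAt (hU.mem_nhds hζ)).differentiableAt (by simp)

lemma dirD_comm {U : Set ℂ} (hU : IsOpen U) {f : ℂ → ℝ}
    (hf : ContDiffOn ℝ (⊤ : ℕ∞) f U) {ζ : ℂ} (hζ : ζ ∈ U) (v w : ℂ) :
    dirD v (dirD w f) ζ = dirD w (dirD v f) ζ := by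
  have hd : DifferentiableAt ℝ (fderiv ℝ f) ζ :=
    ((hf.fderiv_of_isOpen (m := (⊤ : ℕ∞)) hU (by simp)).contDiffAt
      (hU.mem_nhds hζ)).differentiableAt (by simp)
  have hs : IsSymmSndFDerivAt ℝ f ζ :=
    (hf.contDiffAt (hU.mem_nhds hζ)).isSymmSndFDerivAt (by
      rw [minSmoothness_of_isRCLikeNormedField]
      exact WithTop.coe_le_coe.2 (le_top : (2 : ℕ∞) ≤ ⊤))
  have aux (v w : ℂ) : dirD v (dirD w f) ζ = fderiv ℝ (fderiv ℝ f) ζ v w := by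
    have := (hd.hasFDerivAt.clm_apply (hasFDerivAt_const w ζ)).fderiv
    change fderiv ℝ (fun y => fderiv ℝ f y w) ζ v = _
    rw [this]
    simp
  rw [aux, aux, hs.eq]

lemma dirD_congr {U : Set ℂ} (hU : IsOpen U) {f g : ℂ → ℝ} (h : ∀ ζ ∈ U, f ζ = g ζ)
    {ζ : ℂ} (hζ : ζ ∈ U) (v : ℂ) : dirD v f ζ = dirD v g ζ := by
  have : f =ᶠ[nhds ζ] g := Filter.eventually_of_mem (hU.mem_nhds hζ) h
  simp only [dirD, this.fderiv_eq]

lemma dirD_dirD_isBigO {ρ : ℝ} (hρ : 0 < ρ) {f : ℂ → ℝ}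
    (hf : ContDiffOn ℝ (⊤ : ℕ∞) f (ball 0 ρ))
    (hO : f =O[nhds 0] fun ζ : ℂ => ‖ζ‖ ^ 5) {v : ℂ} (hv : ‖v‖ = 1) :
    dirD v (dirD v f) =O[nhds 0] fun ζ : ℂ => ‖ζ‖ ^ 3 := by
  have hF (k : ℕ) : ContDiffOn ℝ (⊤ : ℕ∞) ((dirD v)^[k] f) (ball 0 ρ) := by
    induction k with
    | zero => exact hf
    | succ k ih =>
      rw [Function.iterate_succ_apply']
      exact contDiffOn_dirD isOpen_ball v ih
  obtain ⟨A, hA0, hA⟩ := hO.exists_pos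
  have hcont : ContinuousAt ((dirD v)^[5] f) 0 :=
    (hF 5).continuousOn.continuousAt (isOpen_ball.mem_nhds (mem_ball_self hρ))
  set C : ℝ := |(dirD v)^[5] f 0| + 1
  have hC0 : 0 ≤ C := by positivity
  have hC : ∀ᶠ ζ in nhds (0 : ℂ), |(dirD v)^[5] f ζ| < C :=
    hcont.abs.eventually_lt_const (lt_add_one _)
  obtain ⟨δ, hδ, hball⟩ := Metric.eventually_nhds_iff.1
    ((hA.bound.and hC).and (ball_mem_nhds (0 : ℂ) hρ))
  have main (ζ : ℂ) (r : ℝ) (hr : ‖ζ‖ < r) (hrδ : r < δ / 5) :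
      |dirD v (dirD v f) ζ| ≤ (320 * (A * 5 ^ 5) + 300000 * C) * r ^ 3 := by
    have hr0 : 0 < r := (norm_nonneg _).trans_lt hr
    have hnorm (t : ℝ) (ht : t ∈ Set.Icc 0 (4 * r)) : ‖ζ + t • v‖ < 5 * r := by
      have := norm_add_le ζ (t • v)
      rw [norm_smul, hv, mul_one, Real.norm_of_nonneg ht.1] at this
      linarith [ht.2]
    have hin (t : ℝ) (ht : t ∈ Set.Icc 0 (4 * r)) := hball (y := ζ + t • v) (by
      rw [dist_zero_right]
      linarith [hnorm t ht])
    have := abs_second_deriv_le_of_forward_stencil (A := A * 5 ^ 5) hC0 hr0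
      (fun k t => (dirD v)^[k] f (ζ + t • v)) (fun k t ht => ?_)
      (fun t ht => (hin t ht).1.2.le) (fun t ht => ?_)
    · simpa using this
    · have h1 := ((hF k).differentiableAt_of_isOpen isOpen_ball (hin t ht).2).hasFDerivAt
      have h2 : HasDerivAt (fun t : ℝ => ζ + t • v) v t := by
        simpa using ((hasDerivAt_id t).smul_const v).const_add ζ
      rw [Function.iterate_succ_apply']
      exact h1.comp_hasDerivAt t h2
    · have h1 := (hin t ht).1.1
      rw [Real.norm_eq_abs, norm_pow, norm_norm] at h1
      refine h1.trans ?_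
      rw [mul_assoc, ← mul_pow]
      have := (hnorm t ht).le
      gcongr
  refine Asymptotics.IsBigO.of_bound (320 * (A * 5 ^ 5) + 300000 * C) ?_
  filter_upwards [ball_mem_nhds (0 : ℂ) (by positivity : 0 < δ / 5)] with ζ hζ
  rw [mem_ball_zero_iff] at hζ
  rw [Real.norm_eq_abs, norm_pow, norm_norm]
  have hlim : Filter.Tendsto (fun r : ℝ => (320 * (A * 5 ^ 5) + 300000 * C) * r ^ 3)
      (nhdsWithin ‖ζ‖ (Set.Ioi ‖ζ‖)) (nhds ((320 * (A * 5 ^ 5) + 300000 * C) * ‖ζ‖ ^ 3)) :=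
    (Continuous.tendsto (by fun_prop) _).mono_left nhdsWithin_le_nhds
  refine ge_of_tendsto hlim ?_
  filter_upwards [Ioo_mem_nhdsGT hζ] with r hr
  exact main ζ r hr.1 hr.2

lemma hasFDerivAt_zero_of_sq_isBigO {f : ℂ → ℝ}
    (hO : (fun ζ => f ζ ^ 2) =O[nhds 0] fun ζ : ℂ => ‖ζ‖ ^ 3) :
    HasFDerivAt f (0 : ℂ →L[ℝ] ℝ) 0 := by
  have h1 : f =o[nhds 0] fun ζ : ℂ => ‖ζ‖ :=
    Asymptotics.IsLittleO.of_pow (n := 2)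
      (hO.trans_isLittleO (Asymptotics.isLittleO_norm_pow_norm_pow (by norm_num))) two_ne_zero
  have h0 : f 0 = 0 := by
    obtain ⟨c, hc⟩ := hO.bound
    simpa using hc.self_of_nhds
  rw [hasFDerivAt_iff_isLittleO_nhds_zero]
  simpa [h0] using h1.of_norm_right

lemma FrameJ.apply {J : R6 → R6 →L[ℝ] R6} (hJ : FrameJ J) (p w : R6) :
    J p w =
      ![-w 1 + (1 / 2) * p 5 ^ 2 * w 3 + (p 2 - 2 * p 4 * p 5) * (w 2 - p 4 * w 5)
          + p 3 * p 5 * w 5 - (p 4 * p 5 ^ 2 / 2 + p 4 * p 3) * w 4,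
        w 0 + (1 / 2) * p 5 ^ 2 * (w 2 - p 4 * w 5) - (p 2 - 2 * p 4 * p 5) * w 3
          + p 3 * p 5 * w 4 + (p 4 * p 5 ^ 2 / 2 + p 4 * p 3) * w 5,
        -w 3 + p 4 * w 4, w 2 - p 4 * w 5, -w 5, w 4] := by
  obtain ⟨h1, h2, h3, h4, h5, h6⟩ := hJ p
  have hw : w = (w 0 + (1 / 2) * p 5 ^ 2 * (w 2 - p 4 * w 5) - (p 2 - 2 * p 4 * p 5) * w 3
      + p 3 * p 5 * w 4 + (p 4 * p 5 ^ 2 / 2 + p 4 * p 3) * w 5) • L1 p + w 1 • L2 p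
      + (w 2 - p 4 * w 5) • L3 p + w 3 • L4 p + w 4 • L5 p + w 5 • L6 p := by
    ext i
    fin_cases i <;> simp [L1, L2, L3, L4, L5, L6, e] <;> ring
  conv_lhs => rw [hw]
  simp only [map_add, map_smul, h1, h2, h3, h4, h5, h6]
  ext i
  fin_cases i <;> simp [L1, L2, L3, L4, L5, L6, e] <;> ring

lemma dirD_add {f g : ℂ → ℝ} {ζ : ℂ} (v : ℂ) (hf : DifferentiableAt ℝ f ζ)
    (hg : DifferentiableAt ℝ g ζ) :
    dirD v (fun z => f z + g z) ζ = dirD v f ζ + dirD v g ζ := by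
  simp [dirD, fderiv_fun_add hf hg]

lemma dirD_sub {f g : ℂ → ℝ} {ζ : ℂ} (v : ℂ) (hf : DifferentiableAt ℝ f ζ)
    (hg : DifferentiableAt ℝ g ζ) :
    dirD v (fun z => f z - g z) ζ = dirD v f ζ - dirD v g ζ := by
  simp [dirD, fderiv_fun_sub hf hg]

lemma dirD_mul {f g : ℂ → ℝ} {ζ : ℂ} (v : ℂ) (hf : DifferentiableAt ℝ f ζ)
    (hg : DifferentiableAt ℝ g ζ) :
    dirD v (fun z => f z * g z) ζ = dirD v f ζ * g ζ + f ζ * dirD v g ζ := by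
  simp [dirD, fderiv_fun_mul hf hg]
  ring

lemma dirD_neg {f : ℂ → ℝ} {ζ : ℂ} (v : ℂ) :
    dirD v (fun z => -f z) ζ = -dirD v f ζ := by
  simp [dirD, fderiv_fun_neg]

lemma dirD_const_mul {f : ℂ → ℝ} {ζ : ℂ} (v : ℂ) (c : ℝ) (hf : DifferentiableAt ℝ f ζ) :
    dirD v (fun z => c * f z) ζ = c * dirD v f ζ := by
  simp [dirD, fderiv_const_mul hf]

/-- The Cauchy–Riemann equations satisfied on `U` by the components
`(x₁, y₁, x₂, y₂, x₃, y₃)` of a `J`-holomorphic map. -/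
structure FrameCR (U : Set ℂ) (g : Fin 6 → ℂ → ℝ) : Prop where
  smooth : ∀ i, ContDiffOn ℝ (⊤ : ℕ∞) (g i) U
  eq0 : ∀ ζ ∈ U, dirD Complex.I (g 0) ζ = -dirD 1 (g 1) ζ
      + (1 / 2) * (g 5 ζ * g 5 ζ) * dirD 1 (g 3) ζ
      + (g 2 ζ - 2 * (g 4 ζ * g 5 ζ)) * dirD Complex.I (g 3) ζ
      + g 3 ζ * g 5 ζ * dirD 1 (g 5) ζ
      - ((1 / 2) * (g 4 ζ * (g 5 ζ * g 5 ζ)) + g 4 ζ * g 3 ζ) * dirD 1 (g 4) ζ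
  eq1 : ∀ ζ ∈ U, dirD Complex.I (g 1) ζ = dirD 1 (g 0) ζ
      + (1 / 2) * (g 5 ζ * g 5 ζ) * dirD Complex.I (g 3) ζ
      - (g 2 ζ - 2 * (g 4 ζ * g 5 ζ)) * dirD 1 (g 3) ζ
      + g 3 ζ * g 5 ζ * dirD 1 (g 4) ζ
      + ((1 / 2) * (g 4 ζ * (g 5 ζ * g 5 ζ)) + g 4 ζ * g 3 ζ) * dirD 1 (g 5) ζ
  eq2 : ∀ ζ ∈ U, dirD Complex.I (g 2) ζ = -dirD 1 (g 3) ζ + g 4 ζ * dirD 1 (g 4) ζ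
  eq3 : ∀ ζ ∈ U, dirD Complex.I (g 3) ζ = dirD 1 (g 2) ζ - g 4 ζ * dirD 1 (g 5) ζ
  eq4 : ∀ ζ ∈ U, dirD Complex.I (g 4) ζ = -dirD 1 (g 5) ζ
  eq5 : ∀ ζ ∈ U, dirD Complex.I (g 5) ζ = dirD 1 (g 4) ζ

lemma JHolOn.frameCR {J : R6 → R6 →L[ℝ] R6} (hJ : FrameJ J) {U : Set ℂ} (hU : IsOpen U)
    {γ : ℂ → R6} (hγ : ContDiffOn ℝ (⊤ : ℕ∞) γ U) (hol : JHolOn J U γ) :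
    FrameCR U fun i ζ => γ ζ i := by
  have hcomp (ζ : ℂ) (hζ : ζ ∈ U) (v : ℂ) (i : Fin 6) :
      fderiv ℝ γ ζ v i = dirD v (fun z => γ z i) ζ := by
    have hd : DifferentiableAt ℝ γ ζ :=
      (hγ.contDiffAt (hU.mem_nhds hζ)).differentiableAt (by simp)
    rw [dirD, (hasFDerivAt_pi'.1 hd.hasFDerivAt i).fderiv]
    simp
  have hcr (ζ : ℂ) (hζ : ζ ∈ U) (i : Fin 6) :
      dirD Complex.I (fun z => γ z i) ζ = J (γ ζ) (fderiv ℝ γ ζ 1) i := by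
    rw [← hol ζ hζ 1, mul_one, hcomp ζ hζ]
  have h3 (ζ : ℂ) (hζ : ζ ∈ U) : dirD Complex.I (fun z => γ z 3) ζ
      = dirD 1 (fun z => γ z 2) ζ - γ ζ 4 * dirD 1 (fun z => γ z 5) ζ := by
    rw [hcr ζ hζ, hJ.apply]
    simp [hcomp ζ hζ]
  refine ⟨fun i => contDiffOn_pi.1 hγ i, fun ζ hζ => ?_, fun ζ hζ => ?_, fun ζ hζ => ?_, h3,
    fun ζ hζ => ?_, fun ζ hζ => ?_⟩
  · rw [h3 ζ hζ, hcr ζ hζ, hJ.apply]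
    simp [hcomp ζ hζ]
    ring
  · rw [h3 ζ hζ, hcr ζ hζ, hJ.apply]
    simp [hcomp ζ hζ]
    ring
  all_goals
    rw [hcr ζ hζ, hJ.apply]
    simp [hcomp ζ hζ]

lemma FrameCR.laplacian_three {U : Set ℂ} (hU : IsOpen U) {g : Fin 6 → ℂ → ℝ}
    (h : FrameCR U g) {ζ : ℂ} (hζ : ζ ∈ U) :
    dirD Complex.I (dirD Complex.I (g 3)) ζ =
      dirD 1 (g 4) ζ ^ 2 + dirD 1 (g 5) ζ ^ 2 - dirD 1 (dirD 1 (g 3)) ζ := by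
  have d0 (i : Fin 6) := (h.smooth i).differentiableAt_of_isOpen hU hζ
  have d1 (v : ℂ) (i : Fin 6) :=
    (contDiffOn_dirD hU v (h.smooth i)).differentiableAt_of_isOpen hU hζ
  have e3 := dirD_congr hU h.eq3 hζ Complex.I
  have e2 := dirD_congr hU h.eq2 hζ 1
  have e5 := dirD_congr hU h.eq5 hζ 1
  simp (disch := fun_prop (disch := simp only [d0, d1])) only
    [dirD_add, dirD_sub, dirD_mul, dirD_neg] at e2 e3
  have c2 := dirD_comm hU (h.smooth 2) hζ 1 Complex.I
  have c5 := dirD_comm hU (h.smooth 5) hζ 1 Complex.I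
  have f4 := h.eq4 ζ hζ
  rw [f4] at e3
  linear_combination e3 + e2 - c2 - g 4 ζ * (e5 - c5)

lemma FrameCR.laplacian_one {U : Set ℂ} (hU : IsOpen U) {g : Fin 6 → ℂ → ℝ}
    (h : FrameCR U g) {ζ : ℂ} (hζ : ζ ∈ U) :
    dirD 1 (dirD 1 (g 1)) ζ + dirD Complex.I (dirD Complex.I (g 1)) ζ =
      dirD 1 (g 3) ζ ^ 2 + dirD Complex.I (g 3) ζ ^ 2 := by
  have d0 (i : Fin 6) := (h.smooth i).differentiableAt_of_isOpen hU hζ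
  have d1 (v : ℂ) (i : Fin 6) :=
    (contDiffOn_dirD hU v (h.smooth i)).differentiableAt_of_isOpen hU hζ
  have e0 := dirD_congr hU h.eq0 hζ 1
  have e1 := dirD_congr hU h.eq1 hζ Complex.I
  have e4 := dirD_congr hU h.eq4 hζ 1
  have e5 := dirD_congr hU h.eq5 hζ 1
  simp (disch := fun_prop (disch := simp only [d0, d1])) only
    [dirD_add, dirD_sub, dirD_const_mul, dirD_mul, dirD_neg] at e0 e1 e4
  rw [dirD_comm hU (h.smooth 0) hζ 1 Complex.I] at e0
  rw [dirD_comm hU (h.smooth 3) hζ 1 Complex.I] at e0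
  rw [dirD_comm hU (h.smooth 4) hζ 1 Complex.I] at e4
  rw [dirD_comm hU (h.smooth 5) hζ 1 Complex.I] at e5
  have f2 : dirD 1 (g 2) ζ = dirD Complex.I (g 3) ζ + g 4 ζ * dirD 1 (g 5) ζ := by
    linear_combination -h.eq3 ζ hζ
  simp only [h.laplacian_three hU hζ, h.eq2 ζ hζ, f2, h.eq4 ζ hζ, h.eq5 ζ hζ, e4, e5] at e0 e1
  linear_combination e1 + e0

lemma deriv_ofReal_apply {γ : ℂ → R6} (hd : DifferentiableAt ℝ γ 0) (i : Fin 6) :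
    dirD 1 (fun z => γ z i) 0 = deriv (fun t : ℝ => γ t) 0 i := by
  have h : HasDerivAt (fun t : ℝ => γ t) (fderiv ℝ γ 0 1) 0 := by
    have hd' : HasFDerivAt γ (fderiv ℝ γ 0) ((0 : ℝ) : ℂ) := by simpa using hd.hasFDerivAt
    exact hd'.comp_hasDerivAt (0 : ℝ) Complex.ofRealCLM.hasDerivAt
  rw [h.deriv, dirD, (hasFDerivAt_pi'.1 hd.hasFDerivAt i).fderiv]
  simp

open Asymptotics in
/-- Theorem 1.1: no `J`-holomorphic disc through `0` with initial
derivative `L₅(0)` is tangent to `M = {y₁ = 0}` at order `5` at `0`. -/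
theorem stmt6 (J : R6 → R6 →L[ℝ] R6) (hJ : FrameJ J) :
    ¬ ∃ ρ : ℝ, 0 < ρ ∧ ∃ γ : ℂ → R6,
        ContDiffOn ℝ (⊤ : ℕ∞) γ (Metric.ball 0 ρ) ∧
        JHolOn J (Metric.ball 0 ρ) γ ∧
        γ 0 = 0 ∧
        deriv (fun t : ℝ => γ t) 0 = L5 0 ∧
        (fun ζ : ℂ => phi6 (γ ζ)) =O[nhds 0] (fun ζ : ℂ => ‖ζ‖ ^ 5) := by
  rintro ⟨ρ, hρ, γ, hγ, hol, -, hder, hO⟩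
  have h0 : (0 : ℂ) ∈ ball (0 : ℂ) ρ := mem_ball_self hρ
  have h := hol.frameCR hJ isOpen_ball hγ
  have hlap := (dirD_dirD_isBigO hρ (h.smooth 1) hO (v := 1) (by simp)).add
    (dirD_dirD_isBigO hρ (h.smooth 1) hO (v := Complex.I) (by simp))
  have hsq (v : ℂ) (hv : v = 1 ∨ v = Complex.I) :
      dirD v (dirD v fun z => γ z 3) 0 = 0 := by
    have hv2 : (fun ζ => dirD v (fun z => γ z 3) ζ ^ 2) =O[nhds 0] fun ζ : ℂ => ‖ζ‖ ^ 3 := by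
      refine IsBigO.trans (IsBigO.of_bound 1 ?_) hlap
      filter_upwards [isOpen_ball.mem_nhds h0] with ζ hζ
      rw [h.laplacian_one isOpen_ball hζ, one_mul, Real.norm_of_nonneg (by positivity),
        Real.norm_of_nonneg (by positivity)]
      rcases hv with rfl | rfl
      · exact le_add_of_nonneg_right (sq_nonneg _)
      · exact le_add_of_nonneg_left (sq_nonneg _)
    rw [dirD, (hasFDerivAt_zero_of_sq_isBigO hv2).fderiv]
    simp
  have h4 : dirD 1 (fun z => γ z 4) 0 = 1 := by
    rw [deriv_ofReal_apply ((hγ.contDiffAt (isOpen_ball.mem_nhds h0)).differentiableAt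
      (by simp)), hder]
    simp [L5, e]
  have hl := h.laplacian_three isOpen_ball h0
  simp only [hsq 1 (Or.inl rfl), hsq Complex.I (Or.inr rfl), h4] at hl
  nlinarith [sq_nonneg (dirD 1 (fun z => γ z 5) 0)]
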